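/- There is a 2-clause Achlioptas rule for random 2-SAT (namely: select the first clause if it contains at least two positive literals, otherwise select the second clause) such that the formula Φ_m generated after m = ⌊1.055·n⌋ steps is satisfiable with probability tending to 1 as n → ∞. -/

import Mathlib

open Finset Filter

/-- A literal over `n` variables: a variable together with a sign (`true` = positive). -/
abbrev Lit (n : ℕ) := Fin n × Bool

/-- A `k`-clause over `n` variables: a set of `k` literals on `k` distinct variables.
There are `C(n,k) * 2^k` such clauses. -/
abbrev Clause (n k : ℕ) :=
  {C : Finset (Lit n) // C.card = k ∧ (C.image Prod.fst).card = k}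

/-- The number of positive literals in a clause. -/
def Clause.posCount {n k : ℕ} (C : Clause n k) : ℕ :=
  (C.1.filter fun p => p.2 = true).card

/-- The assignment `σ` satisfies the clause `C`. -/
def Sat {n k : ℕ} (σ : Fin n → Bool) (C : Clause n k) : Prop :=
  ∃ p ∈ C.1, σ p.1 = p.2

/-- A formula (a finite sequence of clauses) is satisfiable. -/
def Satisfiable {n k m : ℕ} (Φ : Fin m → Clause n k) : Prop :=
  ∃ σ : Fin n → Bool, ∀ i, Sat σ (Φ i)

/-- The Achlioptas rule: select the first among the first `l - 1` presented clauses
containing at least two positive literals; if there is none, select the `l`-th clause. -/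
def select {n k l : ℕ} (hl : 0 < l) (cs : Fin l → Clause n k) : Clause n k :=
  match (List.finRange l).find? (fun i => decide (i.1 + 1 < l ∧ 2 ≤ (cs i).posCount)) with
  | some i => cs i
  | none => cs ⟨l - 1, Nat.sub_lt hl one_pos⟩

/-- The probability of the event `P` under the uniform distribution on the finite type `α`;
in particular, for `α = Fin m → Fin l → Clause n k` this is the probability that `P` holds
for `m` rounds of `l` clauses drawn independently and uniformly at random with replacement. -/
noncomputable def unifProb {α : Type*} [Fintype α] (P : α → Prop) : ℝ :=
  (Nat.card {a // P a} : ℝ) / (Fintype.card α : ℝ)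


def lneg {n : ℕ} (a : Lit n) : Lit n := (a.1, !a.2)

theorem lneg_lneg {n : ℕ} (a : Lit n) : lneg (lneg a) = a := by simp [lneg]

theorem lneg_ne {n : ℕ} (a : Lit n) : lneg a ≠ a := by
  intro h
  have := congrArg Prod.snd h
  simp [lneg] at this

theorem eq_or_lneg {n : ℕ} {a b : Lit n} (h : a.1 = b.1) : a = b ∨ a = lneg b := by
  rcases a with ⟨a, s⟩
  rcases b with ⟨b, t⟩
  simp only at h
  subst h
  cases s <;> cases t <;> simp [lneg]

theorem lneg_inj {n : ℕ} {a b : Lit n} (h : lneg a = lneg b) : a = b := by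
  rw [← lneg_lneg a, h, lneg_lneg]

/-- implication edge -/
def Imp {n : ℕ} (F : Finset (Clause n 2)) (a b : Lit n) : Prop :=
  ∃ C ∈ F, C.1 = {lneg a, b}

theorem Imp.symm' {n : ℕ} {F : Finset (Clause n 2)} {a b : Lit n} (h : Imp F a b) :
    Imp F (lneg b) (lneg a) := by
  obtain ⟨C, hC, h⟩ := h
  exact ⟨C, hC, by rw [h, lneg_lneg, Finset.pair_comm]⟩

theorem reach_symm {n : ℕ} {F : Finset (Clause n 2)} {a b : Lit n}
    (h : Relation.ReflTransGen (Imp F) a b) :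
    Relation.ReflTransGen (Imp F) (lneg b) (lneg a) := by
  induction h with
  | refl => exact .refl
  | tail _ h ih => exact .head h.symm' ih

def SatF {n : ℕ} (F : Finset (Clause n 2)) : Prop := ∃ σ : Fin n → Bool, ∀ C ∈ F, Sat σ C

theorem clause_split {n : ℕ} (C : Clause n 2) {x : Lit n} (hx : x ∈ C.1) :
    ∃ y, C.1 = {x, y} ∧ x.1 ≠ y.1 := by
  obtain ⟨C, h1, h2⟩ := C
  obtain ⟨a, b, hab, rfl⟩ := Finset.card_eq_two.1 h1
  have hv : a.1 ≠ b.1 := by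
    intro h
    simp [Finset.image_insert, h] at h2
  simp only [Finset.mem_insert, Finset.mem_singleton] at hx
  rcases hx with rfl | rfl
  · exact ⟨b, rfl, hv⟩
  · exact ⟨a, Finset.pair_comm _ _, hv.symm⟩

open Classical in
theorem reach_neg {n : ℕ} {F : Finset (Clause n 2)} (hF : Minimal (fun F => ¬ SatF F) F)
    {C : Clause n 2} (hC : C ∈ F) {x : Lit n} (hx : x ∈ C.1) :
    Relation.ReflTransGen (Imp F) x (lneg x) := by
  by_contra hcon
  set T : Set (Lit n) := {y | Relation.ReflTransGen (Imp F) x y} with hT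
  have cons : ∀ y, y ∈ T → lneg y ∉ T := by
    intro y hy hy'
    have h2 := reach_symm hy'
    rw [lneg_lneg] at h2
    exact hcon (Relation.ReflTransGen.trans hy h2)
  set F' := F.filter (fun C => ∀ y ∈ C.1, y ∉ T) with hF'
  have hs : SatF F' := by
    by_contra hns
    have := hF.2 hns (Finset.filter_subset _ _) hC
    exact (Finset.mem_filter.1 this).2 x hx .refl
  obtain ⟨σ, hσ⟩ := hs
  apply hF.1
  refine ⟨fun i => if (i, true) ∈ T then true else if (i, false) ∈ T then false else σ i, ?_⟩
  have key : ∀ y ∈ T, (if (y.1, true) ∈ T then true else if (y.1, false) ∈ T then false else σ y.1) = y.2 := by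
    rintro ⟨i, s⟩ hy
    cases s
    · have : (i, true) ∉ T := cons _ hy
      simp [this, hy]
    · simp [hy]
  intro D hD
  by_cases h : ∃ y ∈ D.1, y ∈ T
  · obtain ⟨y, hy, hyT⟩ := h
    exact ⟨y, hy, key y hyT⟩
  · push Not at h
    obtain ⟨y, hy, hys⟩ := hσ D (Finset.mem_filter.2 ⟨hD, h⟩)
    refine ⟨y, hy, ?_⟩
    obtain ⟨z, hz, _⟩ := clause_split D hy
    have hny : lneg y ∉ T := by
      intro hny
      have : z ∈ T := Relation.ReflTransGen.tail hny ⟨D, hD, by rw [lneg_lneg, hz]⟩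
      exact h z (by rw [hz]; simp) this
    have hyT := h y hy
    rcases y with ⟨i, s⟩
    have h1 : (i, true) ∉ T := by
      cases s
      · exact hny
      · exact hyT
    have h2 : (i, false) ∉ T := by
      cases s
      · exact hyT
      · exact hny
    simpa [h1, h2] using hys

def Hooked {n : ℕ} (F : Finset (Clause n 2)) (p : List (Lit n)) (b : Lit n) : Prop :=
  List.IsChain (Imp F) (p ++ [b]) ∧ ((p ++ [b]).map Prod.fst).Nodup ∧
    ∃ j ∈ p ++ [b], Imp F b (lneg j)

theorem path_or_hooked {n : ℕ} {F : Finset (Clause n 2)} {a b : Lit n}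
    (h : Relation.ReflTransGen (Imp F) a b) :
    (∃ p b, Hooked F p b) ∨ ∃ p, List.IsChain (Imp F) (p ++ [b]) ∧
      ((p ++ [b]).map Prod.fst).Nodup ∧ (p ++ [b]).head? = some a := by
  induction h with
  | refl => right; exact ⟨[], by simp, by simp, by simp⟩
  | @tail b c _ hbc ih =>
    rcases ih with ih | ⟨p, h1, h2, h3⟩
    · exact .inl ih
    by_cases hc : c ∈ p ++ [b]
    · right
      obtain ⟨s, t, hst⟩ := List.append_of_mem hc
      rw [hst] at h1 h2 h3
      have hpre : s ++ [c] <+: s ++ c :: t := ⟨t, by simp⟩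
      refine ⟨s, h1.prefix hpre, h2.sublist (hpre.sublist.map _), ?_⟩
      cases s <;> simpa using h3
    by_cases hc' : lneg c ∈ p ++ [b]
    · left
      exact ⟨p, b, h1, h2, lneg c, hc', by rwa [lneg_lneg]⟩
    · right
      refine ⟨p ++ [b], ?_, ?_, ?_⟩
      · rw [List.append_assoc]
        simp only [List.cons_append, List.nil_append]
        rw [show p ++ [b, c] = p ++ [b, c] from rfl, List.isChain_append_cons_cons]
        exact ⟨h1, hbc, by simp⟩
      · rw [List.map_append, List.nodup_append]
        refine ⟨h2, by simp, ?_⟩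
        intro x hx y hy hxy
        simp only [List.map_cons, List.map_nil, List.mem_singleton] at hy
        obtain ⟨z, hz, rfl⟩ := List.mem_map.1 hx
        rcases eq_or_lneg (hxy.trans hy) with h | h
        · exact hc (h ▸ hz)
        · exact hc' (h ▸ hz)
      · rw [List.head?_append, h3]; rfl

theorem exists_hooked {n : ℕ} {F : Finset (Clause n 2)} (hF : Minimal (fun F => ¬ SatF F) F) :
    ∃ p b, Hooked F p b := by
  have hne : F.Nonempty := by
    by_contra h
    rw [Finset.not_nonempty_iff_eq_empty] at h
    subst h
    exact hF.1 ⟨fun _ => true, by simp⟩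
  obtain ⟨C, hC⟩ := hne
  obtain ⟨x, hx⟩ : C.1.Nonempty := by
    rw [← Finset.card_pos, C.2.1]; norm_num
  rcases path_or_hooked (reach_neg hF hC hx) with h | ⟨p, _, h2, h3⟩
  · exact h
  · exfalso
    cases p with
    | nil => simp at h3; exact lneg_ne x h3
    | cons y p =>
      simp at h3
      subst h3
      simp [lneg] at h2

theorem exists_bicycle {n : ℕ} {F : Finset (Clause n 2)} (hF : Minimal (fun F => ¬ SatF F) F) :
    ∃ p b, Hooked F p b ∧ ∃ x t u, p ++ [b] = x :: t ∧ Imp F u x ∧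
      u.1 ∈ (p ++ [b]).map Prod.fst := by
  by_contra hcon
  have key : ∀ k : ℕ, ∃ p b, Hooked F p b ∧ k ≤ p.length := by
    intro k
    induction k with
    | zero =>
      obtain ⟨p, b, h⟩ := exists_hooked hF
      exact ⟨p, b, h, Nat.zero_le _⟩
    | succ k ih =>
      obtain ⟨p, b, h, hk⟩ := ih
      obtain ⟨x, t, hxt⟩ : ∃ x t, p ++ [b] = x :: t := by
        cases p with
        | nil => exact ⟨b, [], rfl⟩
        | cons y p => exact ⟨y, p ++ [b], rfl⟩
      have hout : ∃ y, Imp F x y := by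
        cases p with
        | nil =>
          obtain ⟨_, _, j, _, hj⟩ := h
          simp at hxt
          exact ⟨_, hxt.1 ▸ hj⟩
        | cons z p =>
          have h1 := h.1
          simp at hxt
          obtain ⟨rfl, rfl⟩ := hxt
          cases p with
          | nil => simp at h1; exact ⟨_, h1⟩
          | cons z' p => simp at h1; exact ⟨_, h1.1⟩
      obtain ⟨y, C, hC, hCy⟩ := hout
      have hr := reach_neg hF hC (x := lneg x) (by rw [hCy]; simp)
      rw [lneg_lneg] at hr
      rcases Relation.ReflTransGen.cases_tail hr with h' | ⟨u, _, hu⟩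
      · exact absurd h'.symm (lneg_ne x)
      refine ⟨u :: p, b, ⟨?_, ?_, ?_⟩, by simpa using hk⟩
      · rw [List.cons_append, hxt, List.isChain_cons_cons, ← hxt]
        exact ⟨hu, h.1⟩
      · rw [List.cons_append, List.map_cons, List.nodup_cons]
        refine ⟨?_, h.2.1⟩
        intro hmem
        exact hcon ⟨p, b, h, x, t, u, hxt, hu, hmem⟩
      · obtain ⟨j, hj, hj'⟩ := h.2.2
        exact ⟨j, by simp at hj ⊢; tauto, hj'⟩
  obtain ⟨p, b, h, hk⟩ := key (n + 1)
  have := h.2.1.length_le_card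
  simp at this
  omega

/-- The clauses of a bicycle. -/
def bic {n s : ℕ} (w : Fin (s + 1) → Lit n) (u v : Lit n) :
    Option (Option (Fin s)) → Finset (Lit n)
  | none => {lneg u, w 0}
  | some none => {lneg (w (Fin.last s)), v}
  | some (some k) => {lneg (w k.castSucc), w k.succ}

theorem bic_exists {n m : ℕ} (Φ : Fin m → Clause n 2) (h : ¬ Satisfiable Φ) :
    ∃ (s : Fin n) (w : Fin (s.1 + 1) → Lit n) (i j : Fin (s.1 + 1)) (b : Bool),
      Function.Injective (fun k => (w k).1) ∧
      ∀ k, ∃ i', (Φ i').1 = bic w ((w i).1, b) (lneg (w j)) k := by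
  classical
  have h0 : ¬ SatF (Finset.univ.image Φ) := by
    rintro ⟨σ, hσ⟩
    exact h ⟨σ, fun i => hσ _ (Finset.mem_image_of_mem _ (Finset.mem_univ _))⟩
  obtain ⟨F, hFs, hF⟩ := exists_minimal_le_of_wellFoundedLT (fun F => ¬ SatF F) _ h0
  have hImp : ∀ a b, Imp F a b → ∃ i', (Φ i').1 = {lneg a, b} := by
    rintro a b ⟨C, hC, hCe⟩
    obtain ⟨i, _, rfl⟩ := Finset.mem_image.1 (hFs hC)
    exact ⟨i, hCe⟩
  obtain ⟨p, b, ⟨h1, h2, j, hj, hbj⟩, x, t, u, hxt, hux, hu⟩ := exists_bicycle hF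
  have hlen : (p ++ [b]).length = p.length + 1 := by simp
  have hn : p.length < n := by
    have := h2.length_le_card
    simp at this
    omega
  let w : Fin (p.length + 1) → Lit n := fun k => (p ++ [b])[k.1]'(by rw [hlen]; exact k.2)
  have hw0 : w 0 = x := by simp [w, hxt]
  have hwl : w (Fin.last _) = b := by simp [w]
  obtain ⟨i, hi, hiu⟩ := List.mem_map.1 hu
  obtain ⟨ki, hki, rfl⟩ := List.getElem_of_mem hi
  obtain ⟨kj, hkj, rfl⟩ := List.getElem_of_mem hj
  refine ⟨⟨p.length, hn⟩, w, ⟨ki, by simpa using hki⟩, ⟨kj, by simpa using hkj⟩, u.2, ?_, ?_⟩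
  · intro k l hkl
    have := List.nodup_iff_injective_get.1 h2
      (a₁ := ⟨k.1, by simpa using Nat.le_of_lt_succ k.2⟩)
      (a₂ := ⟨l.1, by simpa using Nat.le_of_lt_succ l.2⟩) (by
        simp only [List.get_eq_getElem, List.getElem_map]; exact hkl)
    simpa [Fin.ext_iff] using this
  · intro k
    match k with
    | none =>
      have : ((w ⟨ki, by simpa using hki⟩).1, u.2) = u := by
        ext1
        · exact hiu
        · rfl
      simp only [bic, this, hw0]
      exact hImp _ _ hux
    | some none =>
      simp only [bic, hwl]
      exact hImp _ _ hbj
    | some (some k) =>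
      simp only [bic]
      apply hImp
      have := List.isChain_iff_getElem.1 h1 k.1 (by simp)
      simpa [w] using this

theorem bic_inj {n s : ℕ} (w : Fin (s + 1) → Lit n) (hw : Function.Injective (fun k => (w k).1))
    (u : Lit n) (j : Fin (s + 1)) : Function.Injective (bic w u (lneg (w j))) := by
  have e : ∀ k l, w k = w l → k = l := fun k l h => hw (congrArg Prod.fst h)
  have ne : ∀ k l, w k ≠ lneg (w l) := by
    intro k l h
    have h2 : (w k).1 = (lneg (w l)).1 := congrArg Prod.fst h
    have : k = l := hw h2
    subst this
    exact lneg_ne _ h.symm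
  have a1 : ∀ k, bic w u (lneg (w j)) none ≠ bic w u (lneg (w j)) (some k) := by
    intro k h
    have : w 0 ∈ bic w u (lneg (w j)) (some k) := by rw [← h]; simp [bic]
    match k with
    | none => simp [bic, ne] at this
    | some k =>
      simp [bic, ne] at this
      exact absurd (e _ _ this) (Fin.succ_ne_zero k).symm
  have a2 : ∀ k, bic w u (lneg (w j)) (some none) ≠ bic w u (lneg (w j)) (some (some k)) := by
    intro k h
    have : lneg (w (Fin.last s)) ∈ bic w u (lneg (w j)) (some (some k)) := by
      rw [← h]; simp [bic]
    simp [bic, (ne _ _).symm] at this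
    have := e _ _ (lneg_inj this)
    exact absurd this (Fin.castSucc_lt_last k).ne'
  have a3 : ∀ k l, bic w u (lneg (w j)) (some (some k)) = bic w u (lneg (w j)) (some (some l)) →
      k = l := by
    intro k l h
    have : w k.succ ∈ bic w u (lneg (w j)) (some (some l)) := by rw [← h]; simp [bic]
    simp [bic, ne] at this
    exact Fin.succ_injective _ (e _ _ this)
  intro k l h
  match k, l with
  | none, none => rfl
  | none, some l => exact absurd h (a1 l)
  | some l, none => exact absurd h.symm (a1 l)
  | some none, some none => rfl
  | some none, some (some l) => exact absurd h (a2 l)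
  | some (some l), some none => exact absurd h.symm (a2 l)
  | some (some k), some (some l) => rw [a3 k l h]

theorem unifProb_nonneg {α : Type*} [Fintype α] (P : α → Prop) : 0 ≤ unifProb P := by
  unfold unifProb; positivity

theorem unifProb_le_sum {α I : Type*} [Fintype α] [Fintype I] (P : α → Prop) (Q : I → α → Prop)
    (h : ∀ a, P a → ∃ i, Q i a) : unifProb P ≤ ∑ i, unifProb (Q i) := by
  classical
  unfold unifProb
  rw [← Finset.sum_div]
  gcongr
  rw [Nat.card_eq_fintype_card, Fintype.card_subtype]
  have : (Finset.univ.filter P) ⊆ Finset.univ.biUnion (fun i => Finset.univ.filter (Q i)) := by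
    intro a ha
    simp only [Finset.mem_filter, Finset.mem_univ, true_and, Finset.mem_biUnion] at ha ⊢
    exact h a ha
  have h2 := (Finset.card_le_card this).trans Finset.card_biUnion_le
  have h3 : ∀ i, Nat.card {a // Q i a} = (Finset.univ.filter (Q i)).card := by
    intro i; rw [Nat.card_eq_fintype_card, Fintype.card_subtype]
  simp only [h3]
  exact_mod_cast h2

theorem unifProb_false {α : Type*} [Fintype α] (P : α → Prop) (h : ∀ a, ¬ P a) :
    unifProb P = 0 := by
  have : IsEmpty {a // P a} := ⟨fun a => h a.1 a.2⟩
  simp [unifProb]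

theorem unifProb_compl {α : Type*} [Fintype α] [Nonempty α] (P : α → Prop) :
    unifProb P = 1 - unifProb (fun a => ¬ P a) := by
  classical
  unfold unifProb
  have hc : (Fintype.card α : ℝ) ≠ 0 := by
    exact_mod_cast Fintype.card_ne_zero
  rw [eq_sub_iff_add_eq, ← add_div, div_eq_one_iff_eq hc]
  rw [Nat.card_eq_fintype_card, Nat.card_eq_fintype_card]
  have := Fintype.card_subtype_compl P
  have h2 := Fintype.card_subtype_le P
  rw [this]
  rw [Nat.cast_sub h2]; ring

theorem unifProb_pi {β κ : Type*} [Fintype β] [Nonempty β] [Fintype κ] {m : ℕ} (T : κ → β → Prop)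
    (e : κ → Fin m) (he : Function.Injective e) :
    unifProb (fun A : Fin m → β => ∀ k, T k (A (e k))) = ∏ k, unifProb (T k) := by
  classical
  let S : Fin m → Finset β := fun i => Finset.univ.filter (fun b => ∀ k, e k = i → T k b)
  have h1 : Nat.card {A : Fin m → β // ∀ k, T k (A (e k))} = ∏ i, (S i).card := by
    rw [← Fintype.card_piFinset, Nat.card_eq_fintype_card, Fintype.card_subtype]
    congr 1
    ext A
    simp only [Finset.mem_filter, Finset.mem_univ, true_and, Fintype.mem_piFinset, S]
    constructor
    · rintro h i k rfl; exact h k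
    · intro h k; exact h _ k rfl
  have hc : (Fintype.card β : ℝ) ≠ 0 := by
    exact_mod_cast Fintype.card_ne_zero
  have h2 : unifProb (fun A : Fin m → β => ∀ k, T k (A (e k)))
      = ∏ i, ((S i).card / (Fintype.card β : ℝ)) := by
    unfold unifProb
    rw [h1, Finset.prod_div_distrib]
    simp
  rw [h2]
  symm
  apply Fintype.prod_of_injective e he
  · intro i hi
    have : S i = Finset.univ := by
      ext b
      simp only [S, Finset.mem_filter, Finset.mem_univ, true_and, iff_true]
      intro k hk
      exact absurd ⟨k, hk⟩ hi
    rw [this, Finset.card_univ, div_self hc]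
  · intro k
    unfold unifProb
    rw [Nat.card_eq_fintype_card, Fintype.card_subtype]
    congr 3
    ext b
    simp only [S, Finset.mem_filter, Finset.mem_univ, true_and]
    constructor
    · intro h k' hk'
      rw [he hk']; exact h
    · intro h; exact h k rfl

theorem unifProb_occ {β γ κ : Type*} [Fintype β] [Nonempty β] [Fintype κ] {m : ℕ}
    (f : β → γ) (D : κ → γ) (hD : Function.Injective D) :
    unifProb (fun A : Fin m → β => ∀ k, ∃ i, f (A i) = D k) ≤
      ∏ k, ((m : ℝ) * unifProb (fun b => f b = D k)) := by
  classical
  have h1 := unifProb_le_sum (fun A : Fin m → β => ∀ k, ∃ i, f (A i) = D k)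
    (fun (e : κ → Fin m) A => ∀ k, f (A (e k)) = D k) (fun A h => by
      choose e he using h
      exact ⟨e, he⟩)
  refine h1.trans ?_
  have h2 : ∀ e : κ → Fin m, unifProb (fun A : Fin m → β => ∀ k, f (A (e k)) = D k) ≤
      ∏ k, unifProb (fun b => f b = D k) := by
    intro e
    by_cases he : Function.Injective e
    · exact (unifProb_pi (fun k b => f b = D k) e he).le
    · rw [unifProb_false]
      · exact Finset.prod_nonneg fun k _ => unifProb_nonneg _
      · intro A hA
        apply he
        intro k l hkl
        apply hD
        rw [← hA k, ← hA l, hkl]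
  refine (Finset.sum_le_sum fun e _ => h2 e).trans ?_
  rw [Finset.sum_const, Finset.prod_mul_distrib]
  simp

theorem select_two {n : ℕ} (cs : Fin 2 → Clause n 2) :
    select two_pos cs = if 2 ≤ (cs 0).posCount then cs 0 else cs 1 := by
  unfold select
  have : List.finRange 2 = [0, 1] := by decide
  rw [this]
  by_cases h : 2 ≤ (cs 0).posCount
  · simp [List.find?, h]
  · simp [List.find?, h]

/-- parametrisation of 2-clauses -/
def mkC {n : ℕ} (x : {p : Fin n × Fin n // p.1 < p.2} × Bool × Bool) : Clause n 2 :=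
  ⟨{(x.1.1.1, x.2.1), (x.1.1.2, x.2.2)}, by
    obtain ⟨⟨⟨i, j⟩, h⟩, s, t⟩ := x
    have h' : i ≠ j := ne_of_lt h
    constructor
    · rw [Finset.card_pair]; simp [h']
    · simp [Finset.image_insert, Finset.card_pair h']⟩

theorem mkC_bij {n : ℕ} : Function.Bijective (mkC (n := n)) := by
  constructor
  · rintro ⟨⟨⟨i, j⟩, h⟩, s, t⟩ ⟨⟨⟨i', j'⟩, h'⟩, s', t'⟩ he
    have he := congrArg Subtype.val he
    simp only [mkC] at he
    simp only at h h'
    have m1 : (i, s) ∈ ({(i', s'), (j', t')} : Finset (Lit n)) := by rw [← he]; simp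
    have m2 : (j, t) ∈ ({(i', s'), (j', t')} : Finset (Lit n)) := by rw [← he]; simp
    have m3 : (i', s') ∈ ({(i, s), (j, t)} : Finset (Lit n)) := by rw [he]; simp
    simp only [Finset.mem_insert, Finset.mem_singleton, Prod.mk.injEq] at m1 m2 m3
    simp only [Prod.mk.injEq, Subtype.mk.injEq]
    grind
  · intro C
    obtain ⟨x, hx⟩ : C.1.Nonempty := by
      rw [← Finset.card_pos, C.2.1]; norm_num
    obtain ⟨y, hy, hne⟩ := clause_split C hx
    rcases lt_or_gt_of_ne hne with h | h
    · exact ⟨⟨⟨(x.1, y.1), h⟩, x.2, y.2⟩, Subtype.ext hy.symm⟩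
    · exact ⟨⟨⟨(y.1, x.1), h⟩, y.2, x.2⟩, Subtype.ext (by rw [hy, Finset.pair_comm]; rfl)⟩

theorem card_lt_pairs (n : ℕ) : 
    (Fintype.card {p : Fin n × Fin n // p.1 < p.2} : ℝ) = n * (n - 1) / 2 := by
  have h : Fintype.card {p : Fin n × Fin n // p.1 < p.2} = n.choose 2 := by
    rw [← Fintype.card_fin n, ← Finset.card_univ (α := Fin n), ← Finset.card_powersetCard,
      ← Finset.card_univ, Finset.card_univ (α := Fin n), Fintype.card_fin]
    apply Finset.card_bij (fun p _ => {p.1.1, p.1.2})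
    · rintro ⟨⟨i, j⟩, h⟩ _
      simp [Finset.mem_powersetCard, Finset.card_pair (ne_of_lt h)]
    · rintro ⟨⟨i, j⟩, h⟩ _ ⟨⟨i', j'⟩, h'⟩ _ he
      simp only at he h h'
      have m1 : i ∈ ({i', j'} : Finset (Fin n)) := by rw [← he]; simp
      have m2 : j ∈ ({i', j'} : Finset (Fin n)) := by rw [← he]; simp
      simp only [Finset.mem_insert, Finset.mem_singleton] at m1 m2
      simp only [Prod.mk.injEq, Subtype.mk.injEq]
      grind
    · intro s hs
      obtain ⟨a, b, hab, rfl⟩ := Finset.card_eq_two.1 (Finset.mem_powersetCard.1 hs).2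
      rcases lt_or_gt_of_ne hab with h | h
      · exact ⟨⟨(a, b), h⟩, Finset.mem_univ _, rfl⟩
      · exact ⟨⟨(b, a), h⟩, Finset.mem_univ _, Finset.pair_comm _ _⟩
  rw [h, Nat.cast_choose_two]

theorem card_clause (n : ℕ) : (Fintype.card (Clause n 2) : ℝ) = 2 * n * (n - 1) := by
  rw [← Fintype.card_of_bijective (mkC_bij (n := n))]
  rw [Fintype.card_prod, Nat.cast_mul, card_lt_pairs]
  simp; ring

theorem card_nonpos (n : ℕ) :
    (Nat.card {C : Clause n 2 // ¬ 2 ≤ C.posCount} : ℝ) ≤ 3 / 2 * n * (n - 1) := by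
  classical
  have h1 : Nat.card {C : Clause n 2 // ¬ 2 ≤ C.posCount} ≤
      Nat.card ({p : Fin n × Fin n // p.1 < p.2} × {x : Bool × Bool // x ≠ (true, true)}) := by
    have h0 : ∀ y : {p : Fin n × Fin n // p.1 < p.2} × {x : Bool × Bool // x ≠ (true, true)},
        ¬ 2 ≤ (mkC (y.1, y.2.1)).posCount := by
      rintro ⟨⟨⟨i, j⟩, h⟩, ⟨s, t⟩, hst⟩
      simp only [Clause.posCount, mkC]
      rw [Finset.filter_insert, Finset.filter_singleton]
      cases s <;> cases t <;> simp at hst ⊢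
    apply Nat.card_le_card_of_surjective
      (fun y : {p : Fin n × Fin n // p.1 < p.2} × {x : Bool × Bool // x ≠ (true, true)} =>
        (⟨mkC (y.1, y.2.1), h0 y⟩ : {C : Clause n 2 // ¬ 2 ≤ C.posCount}))
    · rintro ⟨C, hC⟩
      obtain ⟨⟨p, x⟩, rfl⟩ := mkC_bij.2 C
      refine ⟨⟨p, x, ?_⟩, rfl⟩
      rintro rfl
      apply hC
      obtain ⟨⟨i, j⟩, h⟩ := p
      simp only [Clause.posCount, mkC]
      rw [Finset.filter_insert, Finset.filter_singleton]
      simp [Finset.card_pair, ne_of_lt h]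
  have h2 : Nat.card {x : Bool × Bool // x ≠ (true, true)} = 3 := by
    rw [Nat.card_eq_fintype_card]; decide
  rw [Nat.card_prod, h2, Nat.card_eq_fintype_card (α := {p : Fin n × Fin n // p.1 < p.2})] at h1
  calc _ ≤ ((Fintype.card {p : Fin n × Fin n // p.1 < p.2} * 3 : ℕ) : ℝ) := by exact_mod_cast h1
    _ = _ := by rw [Nat.cast_mul, card_lt_pairs]; push_cast; ring

/-- edge weight -/
noncomputable def G {n : ℕ} (a b : Lit n) : ℝ :=
  if a.1 = b.1 then 0 else if a.2 = false ∧ b.2 = true then 1.055 * 7 / 8 / ((n : ℝ) - 1)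
    else 1.055 * 3 / 8 / ((n : ℝ) - 1)

theorem prob_edge {n : ℕ} (hn : 2 ≤ n) (a b : Lit n) :
    ((⌊(1.055 : ℝ) * n⌋₊ : ℕ) : ℝ) *
      unifProb (fun c : Fin 2 → Clause n 2 => (select two_pos c).1 = {lneg a, b}) ≤ G a b := by
  classical
  have hn' : (2 : ℝ) ≤ n := by exact_mod_cast hn
  by_cases hab : a.1 = b.1
  · rw [unifProb_false]
    · simp [G, hab]
    · intro c hc
      have := (select two_pos c).2.2
      rw [hc] at this
      simp [Finset.image_insert, lneg, hab] at this
  have hm : ((⌊(1.055 : ℝ) * n⌋₊ : ℕ) : ℝ) ≤ 1.055 * n := Nat.floor_le (by positivity)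
  set N : ℝ := 2 * n * (n - 1) with hN
  have hNpos : 0 < N := by
    have : (0 : ℝ) < n - 1 := by linarith
    positivity
  have hcard : (Fintype.card (Fin 2 → Clause n 2) : ℝ) = N * N := by
    rw [Fintype.card_fun, Fintype.card_fin, Nat.cast_pow, card_clause]; ring
  -- the two ways
  have hcnt : ((Finset.univ.filter (fun c : Fin 2 → Clause n 2 =>
      (select two_pos c).1 = {lneg a, b})).card : ℝ) ≤
      (if a.2 = false ∧ b.2 = true then N else 0) + 3 / 4 * N := by
    have hD : (lneg a).1 ≠ b.1 := hab
    let D : Clause n 2 := ⟨{lneg a, b}, by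
      constructor
      · rw [Finset.card_pair]; intro h; exact hD (congrArg Prod.fst h)
      · simp [Finset.image_insert, Finset.card_pair hD]⟩
    have hDpos : 2 ≤ D.posCount → (a.2 = false ∧ b.2 = true) := by
      intro h
      simp only [Clause.posCount, D] at h
      rw [Finset.filter_insert, Finset.filter_singleton] at h
      by_contra hc
      rcases a with ⟨i, s⟩
      rcases b with ⟨j, t⟩
      cases s <;> cases t <;> simp [lneg] at hc h
    have hsub : (Finset.univ.filter (fun c : Fin 2 → Clause n 2 =>
        (select two_pos c).1 = {lneg a, b})) ⊆
        (if a.2 = false ∧ b.2 = true then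
          Finset.univ.image (fun x : Clause n 2 => (![D, x] : Fin 2 → Clause n 2)) else ∅) ∪
        Finset.univ.image (fun x : {C : Clause n 2 // ¬ 2 ≤ C.posCount} =>
          (![x.1, D] : Fin 2 → Clause n 2)) := by
      intro c hc
      simp only [Finset.mem_filter, Finset.mem_univ, true_and] at hc
      have hc : select two_pos c = D := Subtype.ext hc
      rw [select_two] at hc
      rw [Finset.mem_union]
      split_ifs at hc with h0
      · left
        rw [hc] at h0
        rw [if_pos (hDpos h0)]
        refine Finset.mem_image.2 ⟨c 1, Finset.mem_univ _, ?_⟩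
        ext1 i
        fin_cases i <;> simp [hc]
      · right
        refine Finset.mem_image.2 ⟨⟨c 0, h0⟩, Finset.mem_univ _, ?_⟩
        ext1 i
        fin_cases i <;> simp [hc]
    have h1 := (Finset.card_le_card hsub).trans (Finset.card_union_le _ _)
    have h2 : ((Finset.univ.image (fun x : {C : Clause n 2 // ¬ 2 ≤ C.posCount} =>
          (![x.1, D] : Fin 2 → Clause n 2))).card : ℝ) ≤ 3 / 4 * N := by
      have h3 := card_nonpos n
      rw [Nat.card_eq_fintype_card] at h3
      refine le_trans (Nat.cast_le.2 Finset.card_image_le) ?_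
      rw [Finset.card_univ]
      rw [hN]; linarith
    have h3 : (((if a.2 = false ∧ b.2 = true then
          Finset.univ.image (fun x : Clause n 2 => (![D, x] : Fin 2 → Clause n 2)) else ∅) :
          Finset _).card : ℝ) ≤ (if a.2 = false ∧ b.2 = true then N else 0) := by
      split_ifs
      · refine le_trans (Nat.cast_le.2 Finset.card_image_le) ?_
        rw [Finset.card_univ, card_clause]
      · simp
    have h4 : ((Finset.univ.filter (fun c : Fin 2 → Clause n 2 =>
        (select two_pos c).1 = {lneg a, b})).card : ℝ) ≤ _ := Nat.cast_le.2 h1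
    rw [Nat.cast_add] at h4
    linarith
  have hp : unifProb (fun c : Fin 2 → Clause n 2 => (select two_pos c).1 = {lneg a, b}) ≤
      ((if a.2 = false ∧ b.2 = true then N else 0) + 3 / 4 * N) / (N * N) := by
    unfold unifProb
    rw [hcard, Nat.card_eq_fintype_card, Fintype.card_subtype]
    gcongr
  refine (mul_le_mul hm hp (unifProb_nonneg _) (by positivity)).trans (le_of_eq ?_)
  have h1 : (n : ℝ) - 1 ≠ 0 := by linarith
  have h2 : (n : ℝ) ≠ 0 := by linarith
  unfold G
  rw [if_neg hab]
  split_ifs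
  · rw [hN]; field_simp; norm_num; try ring
  · rw [hN]; field_simp; norm_num; try ring

noncomputable def hh {n : ℕ} (a : Lit n) : ℝ := if a.2 then 1 else 1.5275

theorem G_nonneg {n : ℕ} (hn : 2 ≤ n) (a b : Lit n) : 0 ≤ G a b := by
  have hn' : (2 : ℝ) ≤ n := by exact_mod_cast hn
  have : (0 : ℝ) < n - 1 := by linarith
  unfold G
  split_ifs <;> positivity

theorem G_le {n : ℕ} (hn : 2 ≤ n) (a b : Lit n) : G a b ≤ 1 / ((n : ℝ) - 1) := by
  have hn' : (2 : ℝ) ≤ n := by exact_mod_cast hn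
  have : (0 : ℝ) < n - 1 := by linarith
  unfold G
  split_ifs
  · positivity
  · gcongr; norm_num
  · gcongr; norm_num

theorem hh_ge {n : ℕ} (a : Lit n) : 1 ≤ hh a := by
  unfold hh; split_ifs <;> norm_num

theorem hh_le {n : ℕ} (a : Lit n) : hh a ≤ 2 := by
  unfold hh; split_ifs <;> norm_num

theorem row {n : ℕ} (hn : 2 ≤ n) (a : Lit n) :
    ∑ b, G a b * hh b ≤ 0.99999 * hh a := by
  have hn' : (2 : ℝ) ≤ n := by exact_mod_cast hn
  have hpos : (0 : ℝ) < n - 1 := by linarith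
  rw [Fintype.sum_prod_type]
  set r : ℝ := (1.055 * (if a.2 then 3 / 8 else 7 / 8) + 1.055 * 3 / 8 * 1.5275) / ((n : ℝ) - 1)
    with hr
  have h1 : ∀ j : Fin n, ∑ t : Bool, G a (j, t) * hh ((j, t) : Lit n) =
      r - (if a.1 = j then r else 0) := by
    intro j
    rw [Fintype.sum_bool]
    by_cases hj : a.1 = j
    · simp [G, hj]
    · cases ha : a.2 <;> simp [G, hh, hj, ha, hr] <;> ring
  simp only [h1]
  rw [Finset.sum_sub_distrib]
  simp only [Finset.sum_ite_eq, Finset.mem_univ, if_true, Finset.sum_const, Finset.card_univ,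
    Fintype.card_fin, nsmul_eq_mul]
  have h2 : (n : ℝ) * r - r = 
      1.055 * (if a.2 then 3 / 8 else 7 / 8) + 1.055 * 3 / 8 * 1.5275 := by
    rw [hr]; field_simp
  rw [h2]
  unfold hh
  split_ifs <;> norm_num

theorem path_sum {n : ℕ} (hn : 2 ≤ n) (s : ℕ) :
    ∑ w : Fin (s + 1) → Lit n, (∏ k : Fin s, G (w k.castSucc) (w k.succ)) * hh (w (Fin.last s))
      ≤ 0.99999 ^ s * (4 * n) := by
  induction s with
  | zero =>
    simp only [Finset.univ_eq_empty, Finset.prod_empty, one_mul, pow_zero]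
    refine (Finset.sum_le_sum fun w _ => hh_le _).trans (le_of_eq ?_)
    simp; ring
  | succ s ih =>
    rw [← (Fin.snocEquiv (fun _ : Fin (s + 2) => Lit n)).sum_comp, Fintype.sum_prod_type,
      Finset.sum_comm]
    have : ∀ w : Fin (s + 1) → Lit n, ∑ b : Lit n,
        (∏ k : Fin (s + 1), G ((Fin.snoc w b : Fin (s + 2) → Lit n) k.castSucc)
          ((Fin.snoc w b : Fin (s + 2) → Lit n) k.succ)) *
          hh ((Fin.snoc w b : Fin (s + 2) → Lit n) (Fin.last (s + 1))) ≤
        0.99999 * ((∏ k : Fin s, G (w k.castSucc) (w k.succ)) * hh (w (Fin.last s))) := by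
      intro w
      have e : ∀ b : Lit n, (∏ k : Fin (s + 1), G ((Fin.snoc w b : Fin (s + 2) → Lit n) k.castSucc)
          ((Fin.snoc w b : Fin (s + 2) → Lit n) k.succ)) *
          hh ((Fin.snoc w b : Fin (s + 2) → Lit n) (Fin.last (s + 1))) =
          (∏ k : Fin s, G (w k.castSucc) (w k.succ)) * (G (w (Fin.last s)) b * hh b) := by
        intro b
        rw [Fin.prod_univ_castSucc]
        simp only [Fin.snoc_castSucc, Fin.succ_castSucc, Fin.succ_last, Fin.snoc_last]
        ring
      simp only [e]
      rw [← Finset.mul_sum]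
      have := mul_le_mul_of_nonneg_left (row hn (w (Fin.last s)))
        (Finset.prod_nonneg fun (k : Fin s) (_ : k ∈ Finset.univ) =>
          G_nonneg hn (w k.castSucc) (w k.succ))
      linarith
    refine (Finset.sum_le_sum fun w _ => this w).trans ?_
    rw [← Finset.mul_sum, pow_succ]
    linarith

theorem clause_nonempty {n : ℕ} (hn : 2 ≤ n) : Nonempty (Clause n 2) :=
  ⟨mkC (⟨(⟨0, by omega⟩, ⟨1, by omega⟩), by simp [Fin.lt_def]⟩, true, true)⟩

theorem unsat_bound {n : ℕ} (hn : 2 ≤ n) :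
    unifProb (fun A : Fin (⌊(1.055 : ℝ) * n⌋₊) → Fin 2 → Clause n 2 =>
          ¬ Satisfiable (fun i => select two_pos (A i))) ≤
      ∑ s : Fin n, 8 * n / ((n : ℝ) - 1) ^ 2 * (((s.1 : ℝ) + 1) ^ 2 * 0.99999 ^ s.1) := by
  have := clause_nonempty hn
  have hn' : (2 : ℝ) ≤ n := by exact_mod_cast hn
  have hpos : (0 : ℝ) < n - 1 := by linarith
  refine (unifProb_le_sum
    (I := Σ s : Fin n, (Fin (s.1 + 1) → Lit n) × Fin (s.1 + 1) × Fin (s.1 + 1) × Bool) _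
    (fun x A => Function.Injective (fun k => (x.2.1 k).1) ∧
      ∀ k, ∃ i', (select two_pos (A i')).1 =
        bic x.2.1 ((x.2.1 x.2.2.1).1, x.2.2.2.2) (lneg (x.2.1 x.2.2.2.1)) k) ?_).trans ?_
  · intro A hA
    obtain ⟨s, w, i, j, b, h1, h2⟩ := bic_exists _ hA
    exact ⟨⟨s, w, i, j, b⟩, h1, h2⟩
  rw [Fintype.sum_sigma]
  refine Finset.sum_le_sum fun s _ => ?_
  have hq : ∀ y : (Fin (s.1 + 1) → Lit n) × Fin (s.1 + 1) × Fin (s.1 + 1) × Bool,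
      unifProb (fun A : Fin (⌊(1.055 : ℝ) * n⌋₊) → Fin 2 → Clause n 2 =>
        Function.Injective (fun k => (y.1 k).1) ∧
        ∀ k, ∃ i', (select two_pos (A i')).1 =
        bic y.1 ((y.1 y.2.1).1, y.2.2.2) (lneg (y.1 y.2.2.1)) k) ≤
      (1 / ((n : ℝ) - 1)) ^ 2 * ((∏ k : Fin s.1, G (y.1 k.castSucc) (y.1 k.succ)) *
        hh (y.1 (Fin.last s.1))) := by
    rintro ⟨w, i, j, b⟩
    have hG : 0 ≤ ∏ k : Fin s.1, G (w k.castSucc) (w k.succ) :=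
      Finset.prod_nonneg fun k _ => G_nonneg hn _ _
    have hh1 := hh_ge (w (Fin.last s.1))
    by_cases hw : Function.Injective (fun k => (w k).1)
    · simp only [hw, true_and]
      refine (unifProb_occ (fun c : Fin 2 → Clause n 2 => (select two_pos c).1) _
        (bic_inj w hw ((w i).1, b) j)).trans ?_
      rw [Fintype.prod_option, Fintype.prod_option]
      simp only [bic]
      have e1 := (prob_edge hn ((w i).1, b) (w 0)).trans (G_le hn _ _)
      have e2 := (prob_edge hn (w (Fin.last s.1)) (lneg (w j))).trans (G_le hn _ _)
      have e3 := Finset.prod_le_prod (s := Finset.univ)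
        (fun (k : Fin s.1) _ => mul_nonneg (Nat.cast_nonneg _) (unifProb_nonneg _))
        (fun k _ => prob_edge hn (w k.castSucc) (w k.succ))
      have hr : 0 ≤ 1 / ((n : ℝ) - 1) := by positivity
      have e4 : ∏ k : Fin s.1, G (w k.castSucc) (w k.succ) ≤
        (∏ k : Fin s.1, G (w k.castSucc) (w k.succ)) * hh (w (Fin.last s.1)) :=
        le_mul_of_one_le_right hG hh1
      rw [pow_two, mul_assoc (1 / ((n : ℝ) - 1))]
      refine mul_le_mul e1 (mul_le_mul e2 (e3.trans e4) ?_ hr) ?_ hr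
      · exact Finset.prod_nonneg fun k _ => mul_nonneg (Nat.cast_nonneg _) (unifProb_nonneg _)
      · exact mul_nonneg (mul_nonneg (Nat.cast_nonneg _) (unifProb_nonneg _))
          (Finset.prod_nonneg fun k _ => mul_nonneg (Nat.cast_nonneg _) (unifProb_nonneg _))
    · rw [unifProb_false]
      · have : 0 ≤ hh (w (Fin.last s.1)) := by linarith
        positivity
      · intro A hA; exact hw hA.1
  refine (Finset.sum_le_sum fun y _ => hq y).trans ?_
  rw [Fintype.sum_prod_type]
  simp only [Finset.sum_const]
  rw [← Finset.smul_sum, ← Finset.mul_sum]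
  have hp := path_sum hn s.1
  simp only [Finset.card_univ, Fintype.card_prod, Fintype.card_fin, Fintype.card_bool,
    nsmul_eq_mul]
  push_cast
  calc _ ≤ ((s.1 : ℝ) + 1) * ((s.1 + 1) * 2) *
        ((1 / ((n : ℝ) - 1)) ^ 2 * (0.99999 ^ s.1 * (4 * n))) := by gcongr
    _ = _ := by field_simp; ring

theorem summ : Summable (fun s : ℕ => ((s : ℝ) + 1) ^ 2 * 0.99999 ^ s) := by
  have h := summable_pow_mul_geometric_of_norm_lt_one 2 (r := (0.99999 : ℝ)) (by norm_num)
  have h2 := ((summable_nat_add_iff 1).2 h).mul_right (1 / 0.99999)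
  refine h2.congr fun s => ?_
  push_cast
  rw [pow_succ (0.99999 : ℝ)]; norm_num; ring

theorem unsat_bound' {n : ℕ} (hn : 2 ≤ n) :
    unifProb (fun A : Fin (⌊(1.055 : ℝ) * n⌋₊) → Fin 2 → Clause n 2 =>
          ¬ Satisfiable (fun i => select two_pos (A i))) ≤
      32 * (∑' s : ℕ, ((s : ℝ) + 1) ^ 2 * 0.99999 ^ s) / n := by
  have hn' : (2 : ℝ) ≤ n := by exact_mod_cast hn
  have hpos : (0 : ℝ) < n - 1 := by linarith
  refine (unsat_bound hn).trans ?_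
  rw [← Finset.mul_sum, Fin.sum_univ_eq_sum_range (fun s : ℕ => ((s : ℝ) + 1) ^ 2 * 0.99999 ^ s)]
  have h1 := summ.sum_le_tsum (Finset.range n) (fun s _ => by positivity)
  have h2 : 8 * n / ((n : ℝ) - 1) ^ 2 ≤ 32 / n := by
    rw [div_le_div_iff₀ (by positivity) (by positivity)]
    nlinarith
  calc _ ≤ 32 / (n : ℝ) * (∑' s : ℕ, ((s : ℝ) + 1) ^ 2 * 0.99999 ^ s) := by gcongr
    _ = _ := by ring

/-- The 2-clause Achlioptas rule `select` for random 2-SAT (select the first clause if it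
contains at least two positive literals, otherwise select the second) generates a formula
that is satisfiable whp after `⌊1.055 * n⌋` steps. -/
theorem achlioptas_2sat_delay :
    Tendsto (fun n : ℕ =>
        unifProb (fun A : Fin (⌊(1.055 : ℝ) * n⌋₊) → Fin 2 → Clause n 2 =>
          Satisfiable (fun i => select two_pos (A i))))
      atTop (nhds 1) := by
  have hlim : Tendsto (fun n : ℕ =>
      1 - 32 * (∑' s : ℕ, ((s : ℝ) + 1) ^ 2 * 0.99999 ^ s) / (n : ℝ)) atTop (nhds 1) := by
    have := (tendsto_const_div_atTop_nhds_zero_nat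
      (32 * (∑' s : ℕ, ((s : ℝ) + 1) ^ 2 * 0.99999 ^ s))).const_sub 1
    simpa using this
  refine tendsto_of_tendsto_of_tendsto_of_le_of_le' hlim tendsto_const_nhds ?_ ?_
  · filter_upwards [eventually_ge_atTop 2] with n hn
    have := clause_nonempty hn
    rw [unifProb_compl]
    linarith [unsat_bound' hn]
  · filter_upwards [eventually_ge_atTop 2] with n hn
    have := clause_nonempty hn
    rw [unifProb_compl]
    linarith [unifProb_nonneg (fun A : Fin (⌊(1.055 : ℝ) * n⌋₊) → Fin 2 → Clause n 2 =>
          ¬ Satisfiable (fun i => select two_pos (A i)))]
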